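/- In K one has E_X * F_Y − F_Y * E_X = (Y−X) · (H * H), where E_X(x,y) = 1/(1−xX), F_Y(x,y) = (y−x)/(1−xY), and H(x,y) = (y−x)/((1−xX)(1−xY)). -/

import Mathlib

/-!
`K` is the field of rational functions over ℚ in the six variables
`x₁, x₂, y₁, y₂, X, Y`, realized as the fraction field of
`MvPolynomial (Fin 6) ℚ`.  `starMul` is the Kontsevich–Soibelman shuffle
product of the Cohomological Hall algebra of the Kronecker quiver in
bidegree `(1,1) × (1,1)`, and `starMul'` the one in bidegree `(1,0) × (1,2)`
(evaluated on classes not depending on the `y`-variables of the second factor).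
-/

open MvPolynomial

noncomputable section

abbrev P6 : Type := MvPolynomial (Fin 6) ℚ
abbrev K : Type := FractionRing P6

def x1 : K := algebraMap P6 K (X 0)
def x2 : K := algebraMap P6 K (X 1)
def y1 : K := algebraMap P6 K (X 2)
def y2 : K := algebraMap P6 K (X 3)
def Xv : K := algebraMap P6 K (X 4)
def Yv : K := algebraMap P6 K (X 5)

/-- The shuffle product in bidegree `(1,1) × (1,1)`:
`f*g = (1/((x₂−x₁)(y₂−y₁))) · ( f(x₁,y₁)g(x₂,y₂)(y₂−x₁)² − f(x₁,y₂)g(x₂,y₁)(y₁−x₁)²`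
`− f(x₂,y₁)g(x₁,y₂)(y₂−x₂)² + f(x₂,y₂)g(x₁,y₁)(y₁−x₂)² )`. -/
def starMul (f g : K → K → K) : K :=
  ((x2 - x1) * (y2 - y1))⁻¹ *
    (f x1 y1 * g x2 y2 * (y2 - x1) ^ 2 - f x1 y2 * g x2 y1 * (y1 - x1) ^ 2 -
      f x2 y1 * g x1 y2 * (y2 - x2) ^ 2 + f x2 y2 * g x1 y1 * (y1 - x2) ^ 2)

/-- The shuffle product in bidegree `(1,0) × (1,2)`:
`f∗'g = (1/(x₂−x₁)) · ( f(x₁)g(x₂)(y₁−x₁)²(y₂−x₁)² − f(x₂)g(x₁)(y₁−x₂)²(y₂−x₂)² )`. -/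
def starMul' (f g : K → K) : K :=
  (x2 - x1)⁻¹ *
    (f x1 * g x2 * (y1 - x1) ^ 2 * (y2 - x1) ^ 2 -
      f x2 * g x1 * (y1 - x2) ^ 2 * (y2 - x2) ^ 2)

/-- `E(X)(x,y) = 1/(1−xX)`. -/
def EX : K → K → K := fun x _ => (1 - x * Xv)⁻¹
/-- `E(Y)(x,y) = 1/(1−xY)`. -/
def EY : K → K → K := fun x _ => (1 - x * Yv)⁻¹
/-- `F(X)(x,y) = (y−x)/(1−xX)`. -/
def FX : K → K → K := fun x y => (y - x) / (1 - x * Xv)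
/-- `F(Y)(x,y) = (y−x)/(1−xY)`. -/
def FY : K → K → K := fun x y => (y - x) / (1 - x * Yv)
/-- `G(x,y) = (YE(Y)−XE(X))/(Y−X) = 1/((1−xX)(1−xY))`. -/
def G : K → K → K := fun x _ => ((1 - x * Xv) * (1 - x * Yv))⁻¹
/-- `H(x,y) = (YF(Y)−XF(X))/(Y−X) = (y−x)/((1−xX)(1−xY))`. -/
def H : K → K → K := fun x y => (y - x) / ((1 - x * Xv) * (1 - x * Yv))
/-- `g₀(x) = 1/((1−xX)(1−xY))`. -/
def g0 : K → K := fun x => ((1 - x * Xv) * (1 - x * Yv))⁻¹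

theorem aux_ne (p : P6) (v : Fin 6 → ℚ) (h : MvPolynomial.eval v p ≠ 0) :
    algebraMap P6 K p ≠ 0 := by
  intro h0
  have : p = 0 := (IsFractionRing.injective P6 K) (by rw [h0, map_zero])
  exact h (by rw [this, map_zero])

theorem aux_one_sub (i j : Fin 6) :
    (1 : K) - algebraMap P6 K (X i) * algebraMap P6 K (X j) ≠ 0 := by
  have := aux_ne (1 - X i * X j) 0 (by simp)
  simpa using this

theorem aux_field {F : Type*} [Field F] (a b c d s t D : F) (h1 : 1 - a * s ≠ 0)
    (h2 : 1 - a * t ≠ 0) (h3 : 1 - b * s ≠ 0) (h4 : 1 - b * t ≠ 0) :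
    D * ((1 - a * s)⁻¹ * ((d - b) / (1 - b * t)) * (d - a) ^ 2
        - (1 - a * s)⁻¹ * ((c - b) / (1 - b * t)) * (c - a) ^ 2
        - (1 - b * s)⁻¹ * ((d - a) / (1 - a * t)) * (d - b) ^ 2
        + (1 - b * s)⁻¹ * ((c - a) / (1 - a * t)) * (c - b) ^ 2)
      - D * ((c - a) / (1 - a * t) * (1 - b * s)⁻¹ * (d - a) ^ 2
        - (d - a) / (1 - a * t) * (1 - b * s)⁻¹ * (c - a) ^ 2
        - (c - b) / (1 - b * t) * (1 - a * s)⁻¹ * (d - b) ^ 2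
        + (d - b) / (1 - b * t) * (1 - a * s)⁻¹ * (c - b) ^ 2)
      = (t - s) * (D * (
        (c - a) / ((1 - a * s) * (1 - a * t)) * ((d - b) / ((1 - b * s) * (1 - b * t))) * (d - a) ^ 2
        - (d - a) / ((1 - a * s) * (1 - a * t)) * ((c - b) / ((1 - b * s) * (1 - b * t))) * (c - a) ^ 2
        - (c - b) / ((1 - b * s) * (1 - b * t)) * ((d - a) / ((1 - a * s) * (1 - a * t))) * (d - b) ^ 2
        + (d - b) / ((1 - b * s) * (1 - b * t)) * ((c - a) / ((1 - a * s) * (1 - a * t)))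
          * (c - b) ^ 2)) := by
  generalize hp : 1 - a * s = p at *
  generalize hq : 1 - a * t = q at *
  generalize hr : 1 - b * s = r at *
  generalize hu : 1 - b * t = u at *
  field_simp
  subst hp hq hr hu
  ring

/-- `[E(X),F(Y)]_* = (Y−X)·(H * H)`. -/
theorem stmt10 : starMul EX FY - starMul FY EX = (Yv - Xv) * starMul H H := by
  unfold starMul EX FY H
  exact aux_field x1 x2 y1 y2 Xv Yv _ (aux_one_sub 0 4) (aux_one_sub 0 5)
    (aux_one_sub 1 4) (aux_one_sub 1 5)

end
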